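/- arXiv:2503.11676 — 2 statements merged into one kernel-verified Lean document; each statement's English description precedes it below -/
import Mathlib

section
/- For coprime integers q > p > 1, log f_{p,q}(n) is asymptotic to (log 2)(log n)²/(2 log p log q) as n → ∞. -/
open Filter Real

/-- Number of representations of `n` as a sum of distinct terms of the form `p^a * q^b`. -/
noncomputable def fpq (p q n : ℕ) : ℕ :=
  Set.ncard {S : Finset ℕ | (∀ k ∈ S, ∃ a b : ℕ, k = p ^ a * q ^ b) ∧ S.sum id = n}

def TT (p q : ℕ) : Set ℕ := {k | ∃ a b : ℕ, k = p ^ a * q ^ b}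

def SS (C : Set ℕ) : Set ℕ := {n | ∃ U : Finset ℕ, (∀ k ∈ U, k ∈ C) ∧ U.sum id = n}

lemma pq_inj {p q : ℕ} (hp : 1 < p) (hq : 1 < q) (h : Nat.Coprime p q) {a b a' b' : ℕ}
    (e : p ^ a * q ^ b = p ^ a' * q ^ b') : a = a' ∧ b = b' := by
  have key : ∀ {a b a' b' : ℕ}, p ^ a * q ^ b = p ^ a' * q ^ b' → a ≤ a' ∧ b ≤ b' := by
    intro a b a' b' e
    constructor
    · have h1 : p ^ a ∣ p ^ a' * q ^ b' := e ▸ Dvd.intro _ rfl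
      have h2 : p ^ a ∣ p ^ a' :=
        Nat.Coprime.dvd_of_dvd_mul_right (Nat.Coprime.pow _ _ h) h1
      exact (Nat.pow_dvd_pow_iff_le_right hp).1 h2
    · have h1 : q ^ b ∣ p ^ a' * q ^ b' := e ▸ Dvd.intro_left _ rfl
      have h2 : q ^ b ∣ q ^ b' :=
        Nat.Coprime.dvd_of_dvd_mul_left (Nat.Coprime.pow _ _ h.symm) h1
      exact (Nat.pow_dvd_pow_iff_le_right hq).1 h2
  have := key e
  have := key e.symm
  omega

open Classical in
lemma gap_general (C : Set ℕ) (L : ℕ)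
    (hC : ∀ y, y + 1 ≤ L + ∑ t ∈ (Finset.range (y + 1)).filter (· ∈ C), t) :
    ∀ n, ∃ s ∈ SS C, s ≤ n ∧ n < s + L := by
  have hL : 0 < L := by
    have := hC 0
    have h0 : ∑ t ∈ (Finset.range (0 + 1)).filter (· ∈ C), t = 0 := by
      apply Finset.sum_eq_zero
      intro x hx
      simp at hx
      omega
    omega
  have main : ∀ y n, n < ∑ t ∈ (Finset.range (y + 1)).filter (· ∈ C), t + L →
      ∃ U : Finset ℕ, (∀ k ∈ U, k ∈ C ∧ k ≤ y) ∧ U.sum id ≤ n ∧ n < U.sum id + L := by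
    intro y
    induction y with
    | zero =>
      intro n hn
      have h0 : ∑ t ∈ (Finset.range (0 + 1)).filter (· ∈ C), t = 0 := by
        apply Finset.sum_eq_zero
        intro x hx
        simp at hx
        omega
      refine ⟨∅, by simp, by simp, ?_⟩
      simp
      omega
    | succ y ih =>
      intro n hn
      by_cases hc : n < ∑ t ∈ (Finset.range (y + 1)).filter (· ∈ C), t + L
      · obtain ⟨U, h1, h2⟩ := ih n hc
        exact ⟨U, fun k hk => ⟨(h1 k hk).1, (h1 k hk).2.trans (Nat.le_succ _)⟩, h2⟩
      · by_cases hy : y + 1 ∈ C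
        · rw [Finset.range_add_one, Finset.filter_insert, if_pos hy,
            Finset.sum_insert (by simp)] at hn
          have := hC y
          obtain ⟨U, h1, h2, h3⟩ := ih (n - (y + 1)) (by omega)
          have hnot : y + 1 ∉ U := fun hh => by have := (h1 _ hh).2; omega
          refine ⟨insert (y + 1) U, ?_, ?_, ?_⟩
          · intro k hk
            rcases Finset.mem_insert.1 hk with rfl | hk
            · exact ⟨hy, le_rfl⟩
            · exact ⟨(h1 k hk).1, (h1 k hk).2.trans (Nat.le_succ _)⟩
          · rw [Finset.sum_insert hnot]; simp only [id] at *; omega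
          · rw [Finset.sum_insert hnot]; simp only [id] at *; omega
        · rw [Finset.range_add_one, Finset.filter_insert, if_neg hy] at hn
          exact absurd hn hc
  intro n
  have := hC n
  obtain ⟨U, h1, h2, h3⟩ := main n n (by omega)
  exact ⟨_, ⟨U, fun k hk => (h1 k hk).1, rfl⟩, h2, h3⟩

lemma gap_TT {p q : ℕ} (hp : 1 < p) (hq : 1 < q) (h : Nat.Coprime p q) :
    ∀ n, ∃ s ∈ SS (TT p q), s ≤ n ∧ n < s + q ^ p := by
  classical
  apply gap_general
  intro y
  by_cases hy : y < q ^ p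
  · omega
  push Not at hy
  set f : ℕ → ℕ := fun j => p ^ (Nat.log p (y / q ^ j)) * q ^ j with hf
  have hinj : Set.InjOn f (Finset.range p) := fun a _ b _ e => (pq_inj hp hq h e).2
  have hqj : ∀ j ∈ Finset.range p, 0 < y / q ^ j := by
    intro j hj
    apply Nat.div_pos _ (by positivity)
    exact (Nat.pow_le_pow_right (by omega) (Finset.mem_range.1 hj).le).trans hy
  have h1 : ∑ j ∈ Finset.range p, f j ≤
      ∑ t ∈ (Finset.range (y + 1)).filter (· ∈ TT p q), t := by
    rw [← Finset.sum_image (f := fun t => t) hinj]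
    apply Finset.sum_le_sum_of_subset
    intro t ht
    obtain ⟨j, hj, rfl⟩ := Finset.mem_image.1 ht
    simp only [Finset.mem_filter, Finset.mem_range]
    refine ⟨?_, _, _, rfl⟩
    have := Nat.pow_log_le_self p (hqj j hj).ne'
    have := Nat.mul_le_mul_right (q ^ j) this
    have := Nat.div_mul_le_self y (q ^ j)
    simp only [hf]
    omega
  have h2 : ∀ j ∈ Finset.range p, y + 1 ≤ p * f j := by
    intro j hj
    have h3 := Nat.lt_pow_succ_log_self hp (y / q ^ j)
    rw [Nat.div_lt_iff_lt_mul (by positivity)] at h3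
    simp only [hf]
    rw [pow_succ] at h3
    nlinarith
  have h3 := Finset.sum_le_sum h2
  rw [← Finset.mul_sum] at h3
  simp only [Finset.sum_const, Finset.card_range, smul_eq_mul] at h3
  have := Nat.le_of_mul_le_mul_left h3 (by omega)
  omega

lemma SS_step {p q : ℕ} (hp : 1 < p) (hq : 1 < q) (h : Nat.Coprime p q) {s : ℕ}
    (hs : s ∈ SS (TT p q)) (J : Finset ℕ) : p * s + ∑ j ∈ J, q ^ j ∈ SS (TT p q) := by
  classical
  obtain ⟨U, hU, rfl⟩ := hs
  refine ⟨U.image (fun t => p * t) ∪ J.image (fun j => q ^ j), ?_, ?_⟩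
  · intro k hk
    rcases Finset.mem_union.1 hk with hk | hk
    · obtain ⟨t, ht, rfl⟩ := Finset.mem_image.1 hk
      obtain ⟨a, b, rfl⟩ := hU t ht
      exact ⟨a + 1, b, by ring⟩
    · obtain ⟨j, hj, rfl⟩ := Finset.mem_image.1 hk
      exact ⟨0, j, by ring⟩
  · rw [Finset.sum_union, Finset.sum_image, Finset.sum_image]
    · simp [Finset.mul_sum]
    · intro a _ b _ e
      exact Nat.pow_right_injective hq e
    · intro a _ b _ e
      exact Nat.eq_of_mul_eq_mul_left (by omega) e
    · rw [Finset.disjoint_left]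
      intro x hx hx'
      obtain ⟨t, ht, rfl⟩ := Finset.mem_image.1 hx
      obtain ⟨j, hj, e⟩ := Finset.mem_image.1 hx'
      obtain ⟨a, b, rfl⟩ := hU t ht
      have e' : p ^ 0 * q ^ j = p ^ (a + 1) * q ^ b := by
        rw [pow_zero, one_mul, e]; ring
      have := (pq_inj hp hq h e').1
      omega

lemma AP_lemma {p q : ℕ} (hp : 1 < p) (hq : 1 < q) (hpq : Nat.Coprime p q) :
    ∃ h : ℕ, 0 < h ∧ Nat.Coprime q h ∧
      ∀ K : ℕ, ∃ b, ∀ k < K, b + k * h ∈ SS (TT p q) := by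
  classical
  set φ := Nat.totient p with hφ
  have hφ0 : 0 < φ := Nat.totient_pos.2 (by omega)
  have hmod : q ^ φ ≡ 1 [MOD p] := Nat.ModEq.pow_totient hpq.symm
  have hq1 : 1 < q ^ φ := Nat.one_lt_pow hφ0.ne' hq
  obtain ⟨h, hh⟩ : p ∣ q ^ φ - 1 := (Nat.modEq_iff_dvd' hq1.le).1 hmod.symm
  have hh' : q ^ φ = p * h + 1 := by omega
  have hpos : 0 < h := by
    rcases Nat.eq_zero_or_pos h with rfl | h0
    · simp at hh'; omega
    · exact h0
  refine ⟨h, hpos, ?_, ?_⟩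
  · have : Nat.Coprime (q ^ φ) h := by
      rw [hh']; simp
    exact Nat.Coprime.coprime_dvd_left (dvd_pow_self q hφ0.ne') this
  intro K
  by_contra hcon
  push Not at hcon
  set S := SS (TT p q) with hS
  set L := q ^ p with hL
  set l := L + K * h with hl
  have hLpos : 0 < L := by positivity
  have hlpos : 0 < l := by omega
  -- failing points
  have hfail : ∀ j, ∃ s, s ∈ S ∧ s + h ∉ S ∧ j * l ≤ s ∧ s < (j + 1) * l := by
    intro j
    by_contra hno
    push Not at hno
    obtain ⟨s, hs, h1, h2⟩ := gap_TT hp hq hpq (j * l + L - 1)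
    obtain ⟨k, hk, hk2⟩ := hcon s
    have : ∀ k, k < K → s + k * h ∈ S := by
      intro k
      induction k with
      | zero => intro _; simpa using hs
      | succ k ih =>
        intro hk
        have h3 := ih (by omega)
        by_contra h4
        have h5 := hno (s + k * h) h3 (by rwa [add_mul, one_mul, ← add_assoc] at h4) (by omega)
        have h6 : k * h ≤ K * h := Nat.mul_le_mul_right _ (by omega)
        rw [add_mul] at h5
        omega
    exact hk2 (this k hk)
  choose g hgS hgh hg1 hg2 using hfail
  set a : ℕ → ℕ := fun r => ∑ k ∈ Finset.range r, q ^ (k * φ) with ha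
  have hamod : ∀ r, a r ≡ r [MOD p] := by
    intro r
    induction r with
    | zero => simp [ha, Nat.ModEq]
    | succ r ih =>
      have : a (r + 1) = a r + q ^ (r * φ) := by simp [ha, Finset.sum_range_succ]
      rw [this]
      apply ih.add
      rw [mul_comm, pow_mul]
      simpa using hmod.pow r
  have hamono : Monotone a := by
    apply monotone_nat_of_le_succ
    intro r
    simp [ha, Finset.sum_range_succ]
  have ha1 : a 1 = 1 := by simp [ha]
  set C := a p + p * h + 1 with hC
  let c : ℕ → ℕ := fun N => ((Finset.range N).filter (· ∈ S)).card
  have hmem : ∀ s ∈ S, ∀ r, p * s + a r ∈ S := by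
    intro s hs r
    have := SS_step hp hq hpq hs ((Finset.range r).image (fun k => k * φ))
    rw [Finset.sum_image] at this
    · exact this
    · intro x _ y _ e
      exact Nat.eq_of_mul_eq_mul_right hφ0 e
  have hmem2 : ∀ s ∈ S, p * (s + h) + 1 ∈ S := by
    intro s hs
    have := SS_step hp hq hpq hs {φ}
    rw [Finset.sum_singleton, hh'] at this
    convert this using 1
    ring
  have step : ∀ N, p * c N + N / l ≤ c (p * N + C) := by
    intro N
    set A1 := (Finset.range p ×ˢ (Finset.range N).filter (· ∈ S)).image
      (fun x : ℕ × ℕ => p * x.2 + a x.1) with hA1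
    set B1 := (Finset.range (N / l)).image (fun j => p * (g j + h) + 1) with hB1
    have cA : A1.card = p * c N := by
      rw [hA1, Finset.card_image_of_injOn, Finset.card_product, Finset.card_range]
      rintro ⟨r, s⟩ hx ⟨r', s'⟩ hx' e
      simp only [Finset.coe_product, Set.mem_prod, Finset.mem_coe, Finset.mem_range,
        Finset.mem_filter] at hx hx' e
      have e2 : r ≡ r' [MOD p] := by
        have e3 : (p * s + a r) ≡ (p * s' + a r') [MOD p] := by rw [e]
        have e4 : a r ≡ a r' [MOD p] := by
          simpa [Nat.ModEq, Nat.mul_add_mod] using e3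
        exact (hamod r).symm.trans (e4.trans (hamod r'))
      have e5 : r = r' := Nat.ModEq.eq_of_lt_of_lt e2 hx.1 hx'.1
      subst e5
      have : p * s = p * s' := by omega
      have := Nat.eq_of_mul_eq_mul_left (by omega) this
      rw [this]
    have cB : B1.card = N / l := by
      rw [hB1, Finset.card_image_of_injective, Finset.card_range]
      intro j j' e
      simp only at e
      have e1 : p * (g j + h) = p * (g j' + h) := by omega
      have e2 := Nat.eq_of_mul_eq_mul_left (by omega) e1
      have e3 : g j = g j' := by omega
      have h1 := hg1 j; have h2 := hg2 j; have h3 := hg1 j'; have h4 := hg2 j'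
      rw [e3] at h1 h2
      have h5 := lt_of_mul_lt_mul_right (h1.trans_lt h4) (Nat.zero_le _)
      have h6 := lt_of_mul_lt_mul_right (h3.trans_lt h2) (Nat.zero_le _)
      omega
    have hdis : Disjoint A1 B1 := by
      rw [Finset.disjoint_left]
      intro x hx hx'
      obtain ⟨⟨r, s⟩, hrs, rfl⟩ := Finset.mem_image.1 hx
      obtain ⟨j, hj, e⟩ := Finset.mem_image.1 hx'
      simp only [Finset.mem_product, Finset.mem_range, Finset.mem_filter] at hrs e
      have e2 : r ≡ 1 [MOD p] := by
        have e3 : (p * s + a r) ≡ (p * (g j + h) + 1) [MOD p] := by rw [e]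
        have e4 : a r ≡ 1 [MOD p] := by
          simpa [Nat.ModEq, Nat.mul_add_mod] using e3
        exact (hamod r).symm.trans e4
      have e5 : r = 1 := Nat.ModEq.eq_of_lt_of_lt e2 hrs.1 hp
      subst e5
      rw [ha1] at e
      have e1 : p * (g j + h) = p * s := by omega
      have e2 := Nat.eq_of_mul_eq_mul_left (by omega) e1
      exact hgh j (e2 ▸ hrs.2.2)
    rw [← cA, ← cB, ← Finset.card_union_of_disjoint hdis]
    apply Finset.card_le_card
    intro x hx
    rw [Finset.mem_filter, Finset.mem_range]
    rcases Finset.mem_union.1 hx with hx | hx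
    · obtain ⟨⟨r, s⟩, hrs, rfl⟩ := Finset.mem_image.1 hx
      simp only [Finset.mem_product, Finset.mem_range, Finset.mem_filter] at hrs
      refine ⟨?_, hmem s hrs.2.2 r⟩
      have h1 : a r ≤ a p := hamono hrs.1.le
      have h2 : p * s ≤ p * N := Nat.mul_le_mul_left _ hrs.2.1.le
      simp only
      omega
    · obtain ⟨j, hj, rfl⟩ := Finset.mem_image.1 hx
      refine ⟨?_, hmem2 _ (hgS j)⟩
      rw [Finset.mem_range] at hj
      have h1 : g j < N := by
        have h2 : (j + 1) * l ≤ N / l * l := Nat.mul_le_mul_right _ hj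
        have := Nat.div_mul_le_self N l
        have := hg2 j
        omega
      have h2 : p * g j ≤ p * N := Nat.mul_le_mul_left _ h1.le
      have h3 : 0 < a p := by
        have := hamono hp.le
        omega
      rw [mul_add]
      omega
  -- iterate
  let M : ℕ → ℕ := fun k => Nat.rec l (fun _ N => p * N + C) k
  have hM0 : M 0 = l := rfl
  have hM1 : ∀ k, M (k + 1) = p * M k + C := fun k => rfl
  have lo : ∀ k, p ^ k * l ≤ M k := by
    intro k
    induction k with
    | zero => simp [hM0]
    | succ k ih => rw [hM1, pow_succ]; nlinarith
  have up : ∀ k, M k + C ≤ p ^ k * (l + C) := by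
    intro k
    induction k with
    | zero => simp [hM0]
    | succ k ih => rw [hM1, pow_succ]; nlinarith
  have cc : ∀ k, k * p ^ k ≤ p * c (M k) := by
    intro k
    induction k with
    | zero => simp
    | succ k ih =>
      have h1 := step (M k)
      rw [← hM1] at h1
      have h2 : p ^ k ≤ M k / l := (Nat.le_div_iff_mul_le hlpos).2 (lo k)
      have h3 : k * p ^ k + p ^ k ≤ c (M (k + 1)) := by omega
      calc (k + 1) * p ^ (k + 1) = p * (k * p ^ k + p ^ k) := by ring
        _ ≤ _ := Nat.mul_le_mul_left _ h3
  have cle : ∀ N, c N ≤ N := fun N => by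
    simpa using Finset.card_filter_le (Finset.range N) (· ∈ S)
  have h1 := cc (p * (l + C) + 1)
  have h2 := cle (M (p * (l + C) + 1))
  have h3 := up (p * (l + C) + 1)
  set k := p * (l + C) + 1 with hk
  have h4 : k * p ^ k ≤ p * (p ^ k * (l + C)) := h1.trans (Nat.mul_le_mul_left _ (by omega))
  have h5 : 0 < p ^ k := by positivity
  have h6 : k ≤ p * (l + C) := by
    apply Nat.le_of_mul_le_mul_right _ h5
    calc _ ≤ _ := h4
      _ = _ := by ring
  omega

theorem birch {p q : ℕ} (hp : 1 < p) (hq : 1 < q) (hpq : Nat.Coprime p q) :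
    ∃ N0, ∀ n ≥ N0, n ∈ SS (TT p q) := by
  classical
  have hP : 1 < p ^ 3 := Nat.one_lt_pow (by norm_num) hp
  have hPq : Nat.Coprime (p ^ 3) q := Nat.Coprime.pow_left 3 hpq
  obtain ⟨h, hpos, hcop, hAP⟩ := AP_lemma hP hq hPq
  set H := p * h with hH
  have hHpos : 0 < H := by positivity
  have hqH : Nat.Coprime q H := Nat.Coprime.mul_right hpq.symm hcop
  set ψ := Nat.totient H with hψ
  have hψ0 : 0 < ψ := Nat.totient_pos.2 hHpos
  have hmod : q ^ ψ ≡ 1 [MOD H] := Nat.ModEq.pow_totient hqH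
  set a : ℕ → ℕ := fun r => ∑ k ∈ Finset.range r, q ^ (k * ψ) with ha
  have hamod : ∀ r, a r ≡ r [MOD H] := by
    intro r
    induction r with
    | zero => simp [ha, Nat.ModEq]
    | succ r ih =>
      have : a (r + 1) = a r + q ^ (r * ψ) := by simp [ha, Finset.sum_range_succ]
      rw [this]
      apply ih.add
      rw [mul_comm, pow_mul]
      simpa using hmod.pow r
  have hamono : Monotone a := by
    apply monotone_nat_of_le_succ
    intro r
    simp [ha, Finset.sum_range_succ]
  set L := p ^ 2 * q ^ (p ^ 3) with hL
  obtain ⟨b, hb⟩ := hAP (a H + L + 1)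
  refine ⟨p * b + a H, ?_⟩
  intro n hn
  -- coarse approximation
  obtain ⟨s, hs, hs1, hs2⟩ := gap_TT hP hq hPq ((n - (p * b + a H)) / p ^ 2)
  have hp2 : 0 < p ^ 2 := by positivity
  have e1 : p ^ 2 * s ≤ n - (p * b + a H) := by
    have := (Nat.le_div_iff_mul_le hp2).1 hs1
    rwa [mul_comm]
  have e2 : n - (p * b + a H) < p ^ 2 * s + L := by
    have := (Nat.div_lt_iff_lt_mul hp2).1 hs2
    rw [hL, ← mul_add, mul_comm (p ^ 2)]; exact this
  obtain ⟨v, hv⟩ : ∃ v, n = p ^ 2 * s + p * b + a H + v :=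
    ⟨n - (p ^ 2 * s + p * b + a H), by omega⟩
  have hvL : v < L := by omega
  set r := (a H + v) % H with hr
  have hrH : r < H := Nat.mod_lt _ hHpos
  have har : a r ≤ a H := hamono hrH.le
  have hdvd : H ∣ a H + v - a r := by
    apply (Nat.modEq_iff_dvd' (by omega)).1
    exact (hamod r).trans (Nat.mod_modEq _ _)
  obtain ⟨k, hk⟩ := hdvd
  have hkle : k ≤ H * k := Nat.le_mul_of_pos_left _ hHpos
  have hAPk := hb k (by omega)
  obtain ⟨U1, hU1, sU1⟩ := hs
  obtain ⟨U2, hU2, sU2⟩ := hAPk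
  have hppos : 0 < p := by omega
  refine ⟨(U1.image (fun t => p ^ 2 * t) ∪ U2.image (fun t => p * t)) ∪
    (Finset.range r).image (fun k => q ^ (k * ψ)), ?_, ?_⟩
  · intro x hx
    simp only [Finset.mem_union, Finset.mem_image] at hx
    rcases hx with (⟨t, ht, rfl⟩ | ⟨t, ht, rfl⟩) | ⟨j, hj, rfl⟩
    · obtain ⟨i, j, rfl⟩ := hU1 t ht
      exact ⟨3 * i + 2, j, by ring⟩
    · obtain ⟨i, j, rfl⟩ := hU2 t ht
      exact ⟨3 * i + 1, j, by ring⟩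
    · exact ⟨0, j * ψ, by ring⟩
  · rw [Finset.sum_union, Finset.sum_union, Finset.sum_image, Finset.sum_image, Finset.sum_image]
    · simp only [id] at *
      rw [← Finset.mul_sum, ← Finset.mul_sum, sU1, sU2]
      change p ^ 2 * s + p * (b + k * h) + a r = n
      have : p * (b + k * h) = p * b + H * k := by rw [hH]; ring
      rw [this]
      omega
    · intro x _ y _ e
      exact Nat.eq_of_mul_eq_mul_right hψ0 (Nat.pow_right_injective hq e)
    · intro a _ b _ e
      exact Nat.eq_of_mul_eq_mul_left hppos e
    · intro a _ b _ e
      exact Nat.eq_of_mul_eq_mul_left hp2 e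
    · rw [Finset.disjoint_left]
      intro x hx hx'
      simp only [Finset.mem_image] at hx hx'
      obtain ⟨t, ht, rfl⟩ := hx
      obtain ⟨t', ht', e⟩ := hx'
      obtain ⟨i, j, rfl⟩ := hU1 t ht
      obtain ⟨i', j', rfl⟩ := hU2 t' ht'
      have : p ^ (3 * i' + 1) * q ^ j' = p ^ (3 * i + 2) * q ^ j := by
        calc _ = p * ((p ^ 3) ^ i' * q ^ j') := by ring
          _ = _ := e
          _ = _ := by ring
      have := (pq_inj hp hq hpq this).1
      omega
    · rw [Finset.disjoint_left]
      intro x hx hx'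
      simp only [Finset.mem_union, Finset.mem_image] at hx hx'
      obtain ⟨w, hw, e⟩ := hx'
      rcases hx with ⟨t, ht, rfl⟩ | ⟨t, ht, rfl⟩
      · obtain ⟨i, j, rfl⟩ := hU1 t ht
        have : p ^ 0 * q ^ (w * ψ) = p ^ (3 * i + 2) * q ^ j := by
          calc _ = q ^ (w * ψ) := by ring
            _ = _ := e
            _ = _ := by ring
        have := (pq_inj hp hq hpq this).1
        omega
      · obtain ⟨i, j, rfl⟩ := hU2 t ht
        have : p ^ 0 * q ^ (w * ψ) = p ^ (3 * i + 1) * q ^ j := by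
          calc _ = q ^ (w * ψ) := by ring
            _ = _ := e
            _ = _ := by ring
        have := (pq_inj hp hq hpq this).1
        omega

/-- Lattice points `(b, a)` with `a u + b v ≤ Y`. -/
noncomputable def PP (u v Y : ℝ) : Finset (Σ _ : ℕ, ℕ) :=
  (Finset.range (⌊Y / v⌋₊ + 1)).sigma (fun b => Finset.range (⌊(Y - b * v) / u⌋₊ + 1))

lemma mem_PP {u v Y : ℝ} (hu : 0 < u) (hv : 0 < v) (hY : 0 ≤ Y) (b a : ℕ) :
    (⟨b, a⟩ : Σ _ : ℕ, ℕ) ∈ PP u v Y ↔ a * u + b * v ≤ Y := by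
  unfold PP
  simp only [Finset.mem_sigma, Finset.mem_range, Nat.lt_succ_iff]
  constructor
  · rintro ⟨h1, h2⟩
    rw [Nat.le_floor_iff (by positivity), le_div_iff₀ hv] at h1
    rw [Nat.le_floor_iff (div_nonneg (by linarith) hu.le), le_div_iff₀ hu] at h2
    linarith
  · intro h
    have ha : 0 ≤ (a : ℝ) * u := by positivity
    have hb : 0 ≤ (b : ℝ) * v := by positivity
    refine ⟨Nat.le_floor ?_, Nat.le_floor ?_⟩
    · rw [le_div_iff₀ hv]; linarith
    · rw [le_div_iff₀ hu]; linarith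

lemma card_PP {u v Y : ℝ} (hu : 0 < u) (hv : 0 < v) (hY : 0 ≤ Y) :
    Y ^ 2 / (2 * u * v) ≤ ((PP u v Y).card : ℝ) ∧
    ((PP u v Y).card : ℝ) ≤ (Y + v) * (Y + v + 2 * u) / (2 * u * v) := by
  have hc : ((PP u v Y).card : ℝ) =
      ∑ b ∈ Finset.range (⌊Y / v⌋₊ + 1), ((⌊(Y - b * v) / u⌋₊ : ℝ) + 1) := by
    unfold PP
    rw [Finset.card_sigma]
    push_cast
    simp
  have gauss : ∀ B : ℕ, ∑ b ∈ Finset.range (B + 1), (Y - b * v) / u =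
      (B + 1) * (Y - v * B / 2) / u := by
    intro B
    induction B with
    | zero => simp
    | succ B ih => rw [Finset.sum_range_succ, ih]; push_cast; field_simp; ring
  set B := ⌊Y / v⌋₊ with hB
  have hB1 : (B : ℝ) * v ≤ Y := by
    rw [← le_div_iff₀ hv]; exact Nat.floor_le (by positivity)
  have hB2 : Y ≤ (B + 1) * v := by
    rw [← div_le_iff₀ hv]; exact (Nat.lt_floor_add_one _).le
  have hB0 : (0 : ℝ) ≤ B := Nat.cast_nonneg _
  have hbY : ∀ b ∈ Finset.range (B + 1), 0 ≤ (Y - b * v) / u := by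
    intro b hb
    have : (b : ℝ) ≤ B := by exact_mod_cast Nat.lt_succ_iff.1 (Finset.mem_range.1 hb)
    apply div_nonneg _ hu.le
    nlinarith
  constructor
  · have h1 : ∑ b ∈ Finset.range (B + 1), (Y - b * v) / u ≤ ((PP u v Y).card : ℝ) := by
      rw [hc]
      exact Finset.sum_le_sum fun b _ => (Nat.lt_floor_add_one _).le
    refine le_trans ?_ h1
    rw [gauss, div_le_div_iff₀ (by positivity) hu]
    have h2 : Y * Y ≤ ((B + 1) * v) * (2 * Y - v * B) :=
      mul_le_mul hB2 (by linarith) hY (by positivity)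
    nlinarith
  · have h1 : ((PP u v Y).card : ℝ) ≤ ∑ b ∈ Finset.range (B + 1), ((Y - b * v) / u + 1) := by
      rw [hc]
      apply Finset.sum_le_sum
      intro b hb
      have := Nat.floor_le (hbY b hb)
      linarith
    refine h1.trans ?_
    rw [Finset.sum_add_distrib, gauss]
    simp only [Finset.sum_const, Finset.card_range, nsmul_eq_mul, mul_one]
    push_cast
    rw [le_div_iff₀ (by positivity)]
    have e : ((B + 1) * (Y - v * B / 2) / u + ((B : ℝ) + 1)) * (2 * u * v) =
        ((B + 1) * v) * (2 * Y - v * B + 2 * u) := by field_simp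
    rw [e]
    apply mul_le_mul <;> nlinarith

lemma tendsto_PP {u v : ℝ} (hu : 0 < u) (hv : 0 < v) :
    Tendsto (fun Y : ℝ => ((PP u v Y).card : ℝ) / Y ^ 2) atTop (nhds (1 / (2 * u * v))) := by
  have hinv : Tendsto (fun Y : ℝ => Y⁻¹) atTop (nhds 0) := tendsto_inv_atTop_zero
  have hup : Tendsto (fun Y : ℝ => (1 + v * Y⁻¹) * (1 + (v + 2 * u) * Y⁻¹) / (2 * u * v)) atTop
      (nhds ((1 + v * 0) * (1 + (v + 2 * u) * 0) / (2 * u * v))) :=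
    (((hinv.const_mul v).const_add 1).mul ((hinv.const_mul (v + 2 * u)).const_add 1)).div_const _
  simp only [mul_zero, add_zero, mul_one] at hup
  refine tendsto_of_tendsto_of_tendsto_of_le_of_le' tendsto_const_nhds hup ?_ ?_
  · filter_upwards [eventually_gt_atTop 0] with Y hY
    rw [le_div_iff₀ (by positivity)]
    have := (card_PP hu hv hY.le).1
    calc _ = Y ^ 2 / (2 * u * v) := by ring
      _ ≤ _ := this
  · filter_upwards [eventually_gt_atTop 0] with Y hY
    rw [div_le_iff₀ (by positivity)]
    have := (card_PP hu hv hY.le).2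
    calc _ ≤ _ := this
      _ = _ := by field_simp; ring

lemma log_pq {p q : ℕ} (hp : 1 < p) (hq : 1 < q) (a b : ℕ) :
    Real.log ((p ^ a * q ^ b : ℕ) : ℝ) = a * Real.log p + b * Real.log q := by
  have : (0 : ℝ) < p := by positivity
  have : (0 : ℝ) < q := by positivity
  push_cast
  rw [Real.log_mul (by positivity) (by positivity), Real.log_pow, Real.log_pow]

/-- Value map on lattice points. -/
def vv (p q : ℕ) (x : Σ _ : ℕ, ℕ) : ℕ := p ^ x.2 * q ^ x.1

lemma logpos {p : ℕ} (hp : 1 < p) : 0 < Real.log p := Real.log_pos (by exact_mod_cast hp)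

lemma rep_subset {p q n : ℕ} (hp : 1 < p) (hq : 1 < q) (hn : 0 < n) :
    {S : Finset ℕ | (∀ k ∈ S, ∃ a b : ℕ, k = p ^ a * q ^ b) ∧ S.sum id = n} ⊆
    (((PP (Real.log p) (Real.log q) (Real.log n)).image (vv p q)).powerset : Set (Finset ℕ)) := by
  rintro S ⟨h1, h2⟩
  rw [Finset.mem_coe, Finset.mem_powerset]
  intro k hk
  obtain ⟨a, b, rfl⟩ := h1 k hk
  refine Finset.mem_image.2 ⟨⟨b, a⟩, ?_, rfl⟩
  rw [mem_PP (logpos hp) (logpos hq) (Real.log_natCast_nonneg n), ← log_pq hp hq]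
  have h3 : p ^ a * q ^ b ≤ n := by
    rw [← h2]; exact Finset.single_le_sum (f := id) (fun _ _ => Nat.zero_le _) hk
  apply Real.log_le_log
  · have : 0 < p ^ a * q ^ b := by positivity
    exact_mod_cast this
  · exact_mod_cast h3

lemma upper {p q n : ℕ} (hp : 1 < p) (hq : 1 < q) (hn : 0 < n) :
    Real.log (fpq p q n) ≤
      Real.log 2 * (PP (Real.log p) (Real.log q) (Real.log n)).card := by
  have h1 : fpq p q n ≤ 2 ^ (PP (Real.log p) (Real.log q) (Real.log n)).card := by
    unfold fpq
    refine (Set.ncard_le_ncard (rep_subset hp hq hn) (Finset.finite_toSet _)).trans ?_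
    rw [Set.ncard_coe_finset, Finset.card_powerset]
    exact Nat.pow_le_pow_right (by norm_num) Finset.card_image_le
  rcases Nat.eq_zero_or_pos (fpq p q n) with h0 | h0
  · rw [h0]; simp; positivity
  · have h2 : Real.log (fpq p q n) ≤
        Real.log ((2 : ℝ) ^ (PP (Real.log p) (Real.log q) (Real.log n)).card) := by
      apply Real.log_le_log
      · exact_mod_cast h0
      · exact_mod_cast h1
    rw [Real.log_pow] at h2
    linarith

lemma lower {p q m n N0 : ℕ} (hp : 1 < p) (hq : 1 < q) (hpq : Nat.Coprime p q) (hm : 0 < m)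
    (hn : 0 < n)
    (hN0 : ∀ n ≥ N0, n ∈ SS (TT p (q ^ m))) {Y : ℝ} (hY : 0 ≤ Y)
    (hsum : ((PP (Real.log p) (Real.log q) Y).card : ℝ) * Real.exp Y + N0 ≤ n) :
    Real.log 2 * (((PP (Real.log p) (Real.log q) Y).card : ℝ) -
      (PP (Real.log p) (m * Real.log q) Y).card) ≤ Real.log (fpq p q n) := by
  classical
  have hu := logpos hp
  have hv := logpos hq
  have hmR : (0 : ℝ) < m := by exact_mod_cast hm
  set P := PP (Real.log p) (Real.log q) Y with hP
  set P' := PP (Real.log p) (m * Real.log q) Y with hP'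
  set Q := P.filter (fun x => ¬ m ∣ x.1) with hQ
  have hinj : Function.Injective (vv p q) := by
    rintro ⟨b, a⟩ ⟨b', a'⟩ e
    obtain ⟨h1, h2⟩ := pq_inj hp hq hpq e
    subst h1 h2
    rfl
  set E := Q.image (vv p q) with hE
  have cE : E.card = Q.card := Finset.card_image_of_injective _ hinj
  have cQ : P.card ≤ Q.card + P'.card := by
    have h1 : (P.filter (fun x => m ∣ x.1)).card ≤ P'.card := by
      apply Finset.card_le_card_of_injOn (fun x => (⟨x.1 / m, x.2⟩ : Σ _ : ℕ, ℕ))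
      · rintro ⟨b, a⟩ hx
        simp only [Finset.coe_filter, Set.mem_ofPred_eq] at hx
        obtain ⟨hx1, c, rfl⟩ := hx
        rw [mem_PP hu hv hY] at hx1
        simp only [Nat.mul_div_cancel_left _ hm]
        rw [Finset.mem_coe, mem_PP hu (by positivity) hY]
        push_cast at hx1
        linarith
      · rintro ⟨b, a⟩ hx ⟨b', a'⟩ hx' e
        simp only [Finset.coe_filter, Set.mem_ofPred_eq] at hx hx'
        obtain ⟨hx1, c, rfl⟩ := hx
        obtain ⟨hx1', c', rfl⟩ := hx'
        simp only [Nat.mul_div_cancel_left _ hm] at e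
        cases e
        rfl
    have h2 : (P.filter (fun x => m ∣ x.1)).card + Q.card = P.card := by
      rw [hQ]
      convert Finset.card_filter_add_card_filter_not (s := P) (fun x => m ∣ x.1)
    omega
  have hEsum : ((∑ e ∈ E, e : ℕ) : ℝ) ≤ (P.card : ℝ) * Real.exp Y := by
    push_cast
    have h1 : ∀ e ∈ E, (e : ℝ) ≤ Real.exp Y := by
      intro e he
      obtain ⟨⟨b, a⟩, hx, rfl⟩ := Finset.mem_image.1 he
      have hx1 := (Finset.mem_filter.1 hx).1
      rw [mem_PP hu hv hY, ← log_pq hp hq] at hx1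
      have hpos : 0 < p ^ a * q ^ b := by positivity
      rw [Real.log_le_iff_le_exp (by exact_mod_cast hpos)] at hx1
      exact hx1
    have h2 := Finset.sum_le_card_nsmul _ _ _ h1
    rw [nsmul_eq_mul] at h2
    refine h2.trans ?_
    gcongr
    rw [cE]
    exact Finset.card_filter_le _ _
  have hEsum' : ∑ e ∈ E, e + N0 ≤ n := by
    have : ((∑ e ∈ E, e : ℕ) : ℝ) + N0 ≤ n := by linarith
    exact_mod_cast this
  have hrep : ∀ U : Finset ℕ, U ⊆ E → ∃ V : Finset ℕ, (∀ k ∈ V, k ∈ TT p (q ^ m)) ∧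
      V.sum id = n - U.sum id := by
    intro U hU
    apply hN0
    have : U.sum id ≤ ∑ e ∈ E, e := Finset.sum_le_sum_of_subset hU
    omega
  choose! V hV1 hV2 using hrep
  have hdis : ∀ U ⊆ E, Disjoint E (V U) := by
    intro U hU
    rw [Finset.disjoint_left]
    intro x hx hx'
    obtain ⟨⟨b, a⟩, hx1, rfl⟩ := Finset.mem_image.1 hx
    obtain ⟨a', b', e⟩ := hV1 U hU _ hx'
    rw [← pow_mul] at e
    have := (pq_inj hp hq hpq e).2
    apply (Finset.mem_filter.1 hx1).2
    exact ⟨b', this⟩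
  have hcard : 2 ^ E.card ≤ fpq p q n := by
    unfold fpq
    rw [← Finset.card_powerset, ← Set.ncard_coe_finset]
    have hfin := Set.Finite.subset (Finset.finite_toSet _) (rep_subset hp hq hn)
    apply Set.ncard_le_ncard_of_injOn (fun U => U ∪ V U) _ _ hfin
    · intro U hU
      rw [Finset.mem_coe, Finset.mem_powerset] at hU
      refine ⟨?_, ?_⟩
      · intro k hk
        rcases Finset.mem_union.1 hk with hk | hk
        · obtain ⟨⟨b, a⟩, hx1, rfl⟩ := Finset.mem_image.1 (hU hk)
          exact ⟨a, b, rfl⟩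
        · obtain ⟨a', b', e⟩ := hV1 U hU _ hk
          exact ⟨a', m * b', by rw [e, pow_mul]⟩
      · rw [Finset.sum_union (Finset.disjoint_of_subset_left hU (hdis U hU)), hV2 U hU]
        have : U.sum id ≤ ∑ e ∈ E, e := Finset.sum_le_sum_of_subset hU
        exact Nat.add_sub_cancel' (this.trans (by omega))
    · intro U hU U' hU' e
      rw [Finset.mem_coe, Finset.mem_powerset] at hU hU'
      have key : ∀ U ⊆ E, (U ∪ V U) ∩ E = U := by
        intro U hU
        rw [Finset.union_inter_distrib_right, Finset.inter_eq_left.2 hU,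
          Finset.inter_comm, Finset.disjoint_iff_inter_eq_empty.1 (hdis U hU), Finset.union_empty]
      rw [← key U hU, ← key U' hU']
      simp only at e
      rw [e]
  have h1 : Real.log ((2 : ℝ) ^ E.card) ≤ Real.log (fpq p q n) := by
    apply Real.log_le_log (by positivity)
    exact_mod_cast hcard
  rw [Real.log_pow] at h1
  have h2 : (P.card : ℝ) - P'.card ≤ E.card := by
    rw [cE]
    have : (P.card : ℝ) ≤ Q.card + P'.card := by exact_mod_cast cQ
    linarith
  have h3 : 0 ≤ Real.log 2 := Real.log_nonneg (by norm_num)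
  nlinarith

lemma lower_tendsto {u v : ℝ} (hu : 0 < u) (hv : 0 < v) {m : ℕ} (hm : 2 ≤ m) :
    Tendsto (fun X : ℝ => (2 * u * v) * ((((PP u v ((1 - 1 / (m : ℝ)) * X)).card : ℝ) -
      (PP u (m * v) ((1 - 1 / (m : ℝ)) * X)).card) / X ^ 2)) atTop
      (nhds ((1 - 1 / (m : ℝ)) ^ 3)) := by
  have hmR : (2 : ℝ) ≤ m := by exact_mod_cast hm
  have hm0 : (0 : ℝ) < m := by linarith
  set c : ℝ := 1 - 1 / (m : ℝ) with hc
  have hcpos : 0 < c := by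
    rw [hc, sub_pos, div_lt_one hm0]; linarith
  have hcX : Tendsto (fun X : ℝ => c * X) atTop atTop := tendsto_id.const_mul_atTop hcpos
  have h1 := ((tendsto_PP hu hv).comp hcX).sub
    ((tendsto_PP hu (mul_pos hm0 hv)).comp hcX)
  have h2 := h1.const_mul (2 * u * v * c ^ 2)
  have e : 2 * u * v * c ^ 2 * (1 / (2 * u * v) - 1 / (2 * u * (m * v))) = c ^ 3 := by
    have : c ^ 3 = c ^ 2 * (1 - 1 / (m : ℝ)) := by rw [← hc]; ring
    rw [this]
    field_simp
  rw [e] at h2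
  refine h2.congr' ?_
  filter_upwards [eventually_gt_atTop 0] with X hX
  simp only [Function.comp]
  field_simp

lemma sum_small {u v : ℝ} (hu : 0 < u) (hv : 0 < v) {m : ℕ} (hm : 2 ≤ m) (N0 : ℝ) :
    ∀ᶠ X : ℝ in atTop, ((PP u v ((1 - 1 / (m : ℝ)) * X)).card : ℝ) *
      Real.exp ((1 - 1 / (m : ℝ)) * X) + N0 ≤ Real.exp X := by
  have hmR : (2 : ℝ) ≤ m := by exact_mod_cast hm
  have hm0 : (0 : ℝ) < m := by linarith
  set c : ℝ := 1 - 1 / (m : ℝ) with hc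
  have hcpos : 0 < c := by
    rw [hc, sub_pos, div_lt_one hm0]; linarith
  have hcX : Tendsto (fun X : ℝ => c * X) atTop atTop := tendsto_id.const_mul_atTop hcpos
  have h1 := (tendsto_PP hu hv).comp hcX
  have h2 : Tendsto (fun X : ℝ => X / m) atTop atTop := tendsto_id.atTop_div_const hm0
  have h3 := (Real.tendsto_pow_mul_exp_neg_atTop_nhds_zero 2).comp h2
  have h4 := (h1.mul h3).const_mul (c ^ 2 * m ^ 2)
  have h5 : Tendsto (fun X : ℝ => N0 * Real.exp (-X)) atTop (nhds (N0 * 0)) :=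
    (Real.tendsto_exp_neg_atTop_nhds_zero).const_mul N0
  have h6 := h4.add h5
  simp only [mul_zero, add_zero] at h6
  filter_upwards [h6.eventually (gt_mem_nhds (zero_lt_one)), eventually_gt_atTop 0] with X hX hX0
  simp only [Function.comp] at hX
  have e1 : Real.exp (c * X) = Real.exp X * Real.exp (-(X / m)) := by
    rw [← Real.exp_add]; congr 1; rw [hc]; ring
  have e2 : Real.exp X * Real.exp (-X) = 1 := by rw [← Real.exp_add]; simp
  have e3 : ((PP u v (c * X)).card : ℝ) * Real.exp (c * X) + N0 = Real.exp X *
      (c ^ 2 * m ^ 2 * (((PP u v (c * X)).card : ℝ) / (c * X) ^ 2 *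
        ((X / m) ^ 2 * Real.exp (-(X / m)))) + N0 * Real.exp (-X)) := by
    rw [e1, mul_add]
    congr 1
    · field_simp
    · calc N0 = N0 * (Real.exp X * Real.exp (-X)) := by rw [e2, mul_one]
        _ = _ := by ring
  rw [e3]
  have := Real.exp_pos X
  nlinarith

theorem stmt2 (p q : ℕ) (hp : 1 < p) (hpq' : p < q) (hpq : Nat.Coprime p q) :
    Filter.Tendsto (fun n : ℕ =>
        Real.log (fpq p q n) /
          (Real.log 2 * (Real.log n) ^ 2 / (2 * Real.log p * Real.log q)))
      Filter.atTop (nhds 1) := by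
  have hq : 1 < q := hp.trans hpq'
  have hu := logpos hp
  have hv := logpos hq
  have h2 : 0 < Real.log 2 := Real.log_pos (by norm_num)
  have hX : Tendsto (fun n : ℕ => Real.log n) atTop atTop :=
    Real.tendsto_log_atTop.comp tendsto_natCast_atTop_atTop
  rw [tendsto_order]
  constructor
  · intro a ha
    have hc : Tendsto (fun m : ℕ => (1 - 1 / (m : ℝ)) ^ 3) atTop (nhds ((1 - 0) ^ 3)) :=
      (tendsto_one_div_atTop_nhds_zero_nat.const_sub 1).pow 3
    simp only [sub_zero, one_pow] at hc
    obtain ⟨m, hma, hm⟩ := ((hc.eventually (lt_mem_nhds ha)).and (eventually_ge_atTop 2)).exists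
    obtain ⟨N0, hN0⟩ := birch hp (Nat.one_lt_pow (by omega : m ≠ 0) hq)
      (Nat.Coprime.pow_right m hpq)
    have ev1 := hX.eventually ((lower_tendsto hu hv hm).eventually (lt_mem_nhds hma))
    have ev2 := hX.eventually (sum_small hu hv hm N0)
    filter_upwards [ev1, ev2, eventually_gt_atTop 0, hX.eventually (eventually_gt_atTop 0)]
      with n h3 h4 hn hXn
    have hnR : (0 : ℝ) < n := by exact_mod_cast hn
    rw [Real.exp_log hnR] at h4
    have hmR : (2 : ℝ) ≤ m := by exact_mod_cast hm
    have hc0 : 0 ≤ 1 - 1 / (m : ℝ) := by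
      rw [sub_nonneg, div_le_one (by linarith)]; linarith
    have h5 := lower hp hq hpq (by omega : 0 < m) hn hN0 (mul_nonneg hc0 hXn.le) h4
    refine h3.trans_le ?_
    rw [le_div_iff₀ (by positivity)]
    refine le_trans (le_of_eq ?_) h5
    field_simp
  · intro a ha
    have h3 := ((tendsto_PP hu hv).comp hX).const_mul (2 * Real.log p * Real.log q)
    rw [mul_one_div_cancel (by positivity)] at h3
    filter_upwards [h3.eventually (gt_mem_nhds ha), eventually_gt_atTop 0,
      hX.eventually (eventually_gt_atTop 0)] with n h4 hn hXn
    refine lt_of_le_of_lt ?_ h4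
    rw [div_le_iff₀ (by positivity)]
    refine (upper hp hq hn).trans (le_of_eq ?_)
    simp only [Function.comp]
    field_simp
end

section
/- Let q ≥ 5 be odd. Then #{n ≤ x : f_{2,q}(n) is odd} ≫_q x^{log((q-1)/2)/log q}. -/
open Filter Real

namespace Aux

/-- Representations of `n`. -/
def R (q n : ℕ) : Set (Finset ℕ) :=
  {S : Finset ℕ | (∀ k ∈ S, ∃ a b : ℕ, k = 2 ^ a * q ^ b) ∧ S.sum id = n}

/-- Representations of all numbers up to `N`. -/
def U (q N : ℕ) : Set (Finset ℕ) :=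
  {S : Finset ℕ | (∀ k ∈ S, ∃ a b : ℕ, k = 2 ^ a * q ^ b) ∧ S.sum id ≤ N}

lemma U_finite (q N : ℕ) : (U q N).Finite := by
  apply (Finset.finite_toSet (Finset.range (N + 1)).powerset).subset
  intro S hS
  simp only [Finset.coe_powerset, Set.mem_preimage, Set.mem_powerset_iff, Finset.coe_subset]
  intro k hk
  have h1 : id k ≤ S.sum id := Finset.single_le_sum (fun _ _ => Nat.zero_le _) hk
  have := hS.2
  simp only [id, Finset.mem_range] at *
  omega

lemma U_succ (q N : ℕ) :
    (U q (N + 1)).ncard = (U q N).ncard + fpq 2 q (N + 1) := by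
  have h : U q (N + 1) = U q N ∪ R q (N + 1) := by
    ext S
    simp only [U, R, Set.mem_union, Set.mem_ofPred_eq]
    have : S.sum id ≤ N + 1 ↔ S.sum id ≤ N ∨ S.sum id = N + 1 := by omega
    tauto
  have hf : (R q (N + 1)).Finite := (U_finite q (N + 1)).subset (by
    rw [h]; exact Set.subset_union_right)
  rw [h, Set.ncard_union_eq _ (U_finite q N) hf]
  · rfl
  · rw [Set.disjoint_left]
    rintro S ⟨_, h1⟩ ⟨_, h2⟩
    omega

lemma U_zero (q : ℕ) (hq : 0 < q) : (U q 0).ncard = 1 := by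
  rw [Set.ncard_eq_one]
  refine ⟨∅, ?_⟩
  ext S
  simp only [U, Set.mem_ofPred_eq, Set.mem_singleton_iff]
  constructor
  · rintro ⟨h1, h2⟩
    rw [Finset.eq_empty_iff_forall_notMem]
    intro k hk
    obtain ⟨a, b, rfl⟩ := h1 k hk
    have h3 : id (2 ^ a * q ^ b) ≤ S.sum id :=
      Finset.single_le_sum (f := id) (fun _ _ => Nat.zero_le _) hk
    have : 0 < 2 ^ a * q ^ b := by positivity
    simp only [id] at h3 h2
    omega
  · rintro rfl
    simp

/-- Binary expansion as a set of powers of two. -/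
def P (m : ℕ) : Finset ℕ := (Finset.equivBitIndices m).image (fun i => 2 ^ i)

lemma P_sum (m : ℕ) : (P m).sum id = m := by
  unfold P
  rw [Finset.sum_image (fun a _ b _ h => Nat.pow_right_injective le_rfl h)]
  exact Finset.equivBitIndices.symm_apply_apply m

lemma P_image (E : Finset ℕ) (m : ℕ) (h : (E.image (fun i => 2 ^ i)).sum id = m) :
    P m = E.image (fun i => 2 ^ i) := by
  rw [Finset.sum_image (fun a _ b _ h => Nat.pow_right_injective le_rfl h)] at h
  have : Finset.equivBitIndices.symm E = m := h
  unfold P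
  rw [← this, Equiv.apply_symm_apply]

lemma not_dvd_two_pow (q i : ℕ) (hq : 5 ≤ q) (hodd : Odd q) : ¬ q ∣ 2 ^ i := by
  intro h
  have hc : Nat.Coprime q (2 ^ i) := Nat.Coprime.pow_right i hodd.coprime_two_right
  have := Nat.Coprime.eq_one_of_dvd hc h
  omega

/-- The bijection. -/
def Psi (q n : ℕ) (S : Finset ℕ) : Finset ℕ :=
  S.image (fun k => q * k) ∪ P (n - q * S.sum id)

lemma mem_Psi (q n : ℕ) (hq : 5 ≤ q) (hodd : Odd q) (S : Finset ℕ) (k : ℕ) :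
    q * k ∈ Psi q n S ↔ k ∈ S := by
  unfold Psi
  rw [Finset.mem_union]
  constructor
  · rintro (h | h)
    · obtain ⟨l, hl, h2⟩ := Finset.mem_image.1 h
      have : l = k := Nat.eq_of_mul_eq_mul_left (by omega) h2
      rwa [← this]
    · obtain ⟨i, _, h2⟩ := Finset.mem_image.1 h
      exact absurd ⟨k, h2⟩ (not_dvd_two_pow q i hq hodd)
  · intro h
    exact Or.inl (Finset.mem_image_of_mem _ h)

lemma f_eq (q n : ℕ) (hq : 5 ≤ q) (hodd : Odd q) :
    fpq 2 q n = (U q (n / q)).ncard := by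
  have himg : R q n = Psi q n '' U q (n / q) := by
    ext T
    constructor
    · rintro ⟨h1, h2⟩
      let S : Finset ℕ := (T.filter (q ∣ ·)).image (· / q)
      let E : Finset ℕ := (T.filter (¬ q ∣ ·)).image (Nat.log 2)
      have hS : S.image (fun k => q * k) = T.filter (q ∣ ·) := by
        simp only [S, Finset.image_image]
        conv_rhs => rw [← Finset.image_id (s := T.filter (q ∣ ·))]
        apply Finset.image_congr
        intro k hk
        simp only [Finset.coe_filter, Set.mem_ofPred_eq] at hk
        simp only [Function.comp, id]
        exact Nat.mul_div_cancel' hk.2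
      have hE : E.image (fun i => 2 ^ i) = T.filter (¬ q ∣ ·) := by
        simp only [E, Finset.image_image]
        conv_rhs => rw [← Finset.image_id (s := T.filter (¬ q ∣ ·))]
        apply Finset.image_congr
        intro k hk
        simp only [Finset.coe_filter, Set.mem_ofPred_eq] at hk
        obtain ⟨a, b, rfl⟩ := h1 k hk.1
        simp only [Function.comp, id]
        rcases b with _ | b
        · simp
        · exact absurd (Dvd.dvd.mul_left (dvd_pow_self q (by omega)) _) hk.2
      have hsumS : (S.image (fun k => q * k)).sum id = q * S.sum id := by
        rw [Finset.sum_image (fun a _ b _ h => Nat.eq_of_mul_eq_mul_left (by omega) h),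
          Finset.mul_sum]
        rfl
      have hsplit : (T.filter (q ∣ ·)).sum id + (T.filter (¬ q ∣ ·)).sum id = n := by
        rw [Finset.sum_filter_add_sum_filter_not, h2]
      rw [← hS, hsumS] at hsplit
      refine ⟨S, ⟨?_, ?_⟩, ?_⟩
      · intro k hk
        have hk' : q * k ∈ T.filter (q ∣ ·) := by
          rw [← hS]; exact Finset.mem_image_of_mem _ hk
        obtain ⟨a, b, hab⟩ := h1 _ (Finset.mem_filter.1 hk').1
        rcases b with _ | b
        · exact absurd ⟨k, by simpa using hab.symm⟩ (not_dvd_two_pow q a hq hodd)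
        · refine ⟨a, b, Nat.eq_of_mul_eq_mul_left (show 0 < q by omega) ?_⟩
          rw [hab]; ring
      · rw [Nat.le_div_iff_mul_le (by omega), mul_comm]
        omega
      · unfold Psi
        rw [P_image E (n - q * S.sum id) (by rw [hE]; omega), hE, hS]
        exact Finset.filter_union_filter_not_eq _ _
    · rintro ⟨S, ⟨h1, h2⟩, rfl⟩
      rw [Nat.le_div_iff_mul_le (by omega), mul_comm] at h2
      constructor
      · intro k hk
        rcases Finset.mem_union.1 hk with h | h
        · obtain ⟨l, hl, rfl⟩ := Finset.mem_image.1 h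
          obtain ⟨a, b, rfl⟩ := h1 l hl
          exact ⟨a, b + 1, by ring⟩
        · obtain ⟨i, _, rfl⟩ := Finset.mem_image.1 h
          exact ⟨i, 0, by simp⟩
      · unfold Psi
        rw [Finset.sum_union, P_sum,
          Finset.sum_image (fun a _ b _ h => Nat.eq_of_mul_eq_mul_left (by omega) h)]
        · have h3 : ∑ x ∈ S, id (q * x) = q * S.sum id := by
            rw [Finset.mul_sum]; rfl
          rw [h3]
          omega
        · rw [Finset.disjoint_left]
          intro k hk hk'
          obtain ⟨l, hl, rfl⟩ := Finset.mem_image.1 hk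
          obtain ⟨i, _, h3⟩ := Finset.mem_image.1 hk'
          exact not_dvd_two_pow q i hq hodd ⟨l, h3⟩
  change (R q n).ncard = _
  rw [himg, Set.ncard_image_of_injOn]
  intro S _ S' _ h
  ext k
  rw [← mem_Psi q n hq hodd S k, ← mem_Psi q n hq hodd S' k, h]

lemma B_card (q : ℕ) (hq : 5 ≤ q) (hodd : Odd q) (j : ℕ) :
    ((q - 1) / 2) ^ j ≤
      ((Finset.range (q ^ j)).filter (fun k => Odd (U q k).ncard)).card := by
  induction j with
  | zero =>
    have : (Finset.range (q ^ 0)).filter (fun k => Odd (U q k).ncard) = {0} := by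
      ext k
      simp only [pow_zero, Finset.mem_filter, Finset.mem_range, Finset.mem_singleton]
      constructor
      · intro h; omega
      · rintro rfl
        rw [U_zero q (by omega)]
        simp
    rw [this]; simp
  | succ j ih =>
    classical
    let φ : ℕ × ℕ → ℕ := fun p =>
      q * p.1 + (2 * p.2 + (if Odd (U q (q * p.1 + 2 * p.2)).ncard then 0 else 1))
    have hε : ∀ p : ℕ × ℕ,
      (if Odd (U q (q * p.1 + 2 * p.2)).ncard then 0 else 1) < 2 := by
        intro p; split_ifs <;> omega
    have key : (((Finset.range (q ^ j)).filter (fun k => Odd (U q k).ncard)) ×ˢ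
        Finset.range ((q - 1) / 2)).card ≤
        ((Finset.range (q ^ (j + 1))).filter (fun k => Odd (U q k).ncard)).card := by
      apply Finset.card_le_card_of_injOn φ
      · rintro ⟨k, r⟩ hp
        simp only [Finset.coe_product, Set.mem_prod, Finset.mem_coe, Finset.mem_filter,
          Finset.mem_range] at hp
        obtain ⟨⟨hk, hko⟩, hr⟩ := hp
        simp only [Finset.coe_filter, Finset.mem_range, Set.mem_ofPred_eq]
        constructor
        · have h1 := hε (k, r)
          have h2 : q * (k + 1) ≤ q * q ^ j := Nat.mul_le_mul_left q hk
          rw [pow_succ']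
          simp only [φ] at *
          rw [mul_add] at h2
          omega
        · simp only [φ]
          split_ifs with h
          · exact h
          · have h3 : fpq 2 q (q * k + 2 * r + 1) = (U q k).ncard := by
              rw [f_eq q _ hq hodd]
              congr 2
              rw [add_assoc, Nat.mul_add_div (by omega), Nat.div_eq_of_lt (by omega), add_zero]
            rw [← add_assoc, U_succ, h3]
            exact (Nat.not_odd_iff_even.1 h).add_odd hko
      · rintro ⟨k, r⟩ hp ⟨k', r'⟩ hp' h
        simp only [Finset.coe_product, Set.mem_prod, Finset.mem_coe, Finset.mem_filter,
          Finset.mem_range] at hp hp'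
        have h1 := hε (k, r)
        have h2 := hε (k', r')
        simp only [φ] at h h1 h2
        generalize (if Odd (U q (q * k + 2 * r)).ncard then 0 else 1) = e at *
        generalize (if Odd (U q (q * k' + 2 * r')).ncard then 0 else 1) = e' at *
        have hk : k = k' := by
          have := congrArg (· / q) h
          rwa [Nat.mul_add_div (by omega), Nat.mul_add_div (by omega),
            Nat.div_eq_of_lt (by omega), Nat.div_eq_of_lt (by omega)] at this
        subst hk
        rw [Prod.mk.injEq]
        omega
    rw [Finset.card_product, Finset.card_range] at key
    rw [pow_succ]
    exact (Nat.mul_le_mul_right _ ih).trans key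

lemma count (q : ℕ) (hq : 5 ≤ q) (hodd : Odd q) (j x : ℕ) (hx : q ^ (j + 1) ≤ x) :
    ((q - 1) / 2) ^ j ≤ ((Finset.Icc 1 x).filter (fun n => Odd (fpq 2 q n))).card := by
  refine (B_card q hq hodd j).trans ?_
  apply Finset.card_le_card_of_injOn (fun k => q * k + 1)
  · intro k hk
    simp only [Finset.coe_filter, Finset.mem_range, Set.mem_ofPred_eq, Finset.mem_Icc] at *
    have h2 : q * (k + 1) ≤ q * q ^ j := Nat.mul_le_mul_left q hk.1
    rw [pow_succ'] at hx
    rw [mul_add] at h2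
    refine ⟨by omega, ?_⟩
    rw [f_eq q _ hq hodd, Nat.mul_add_div (by omega), Nat.div_eq_of_lt (by omega), add_zero]
    exact hk.2
  · intro a _ b _ h
    simp only at h
    exact Nat.eq_of_mul_eq_mul_left (show 0 < q by omega) (by omega)

end Aux

theorem stmt12 (q : ℕ) (hq : 5 ≤ q) (hodd : Odd q) :
    ∃ c : ℝ, 0 < c ∧ ∀ᶠ x : ℕ in Filter.atTop,
      c * (x : ℝ) ^ (Real.log ((q - 1) / 2) / Real.log q) ≤
        (((Finset.Icc 1 x).filter (fun n => Odd (fpq 2 q n))).card : ℝ) := by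
  have hqR : (5 : ℝ) ≤ q := by exact_mod_cast hq
  have hq0 : (0 : ℝ) < q := by linarith
  set α : ℝ := Real.log ((q - 1) / 2) / Real.log q with hα
  have hlog : 0 < Real.log q := Real.log_pos (by linarith)
  have hα0 : 0 ≤ α := div_nonneg (Real.log_nonneg (by linarith)) hlog.le
  have hqα : (q : ℝ) ^ α = (q - 1) / 2 := by
    rw [Real.rpow_def_of_pos hq0, hα, mul_div_cancel₀ _ hlog.ne', Real.exp_log (by linarith)]
  refine ⟨(((q : ℝ) ^ 2) ^ α)⁻¹, by positivity, ?_⟩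
  filter_upwards [Filter.eventually_ge_atTop q] with x hx
  obtain ⟨j, hj⟩ : ∃ j, Nat.log q x = j + 1 :=
    ⟨Nat.log q x - 1, by have := Nat.log_pos (b := q) (by omega) hx; omega⟩
  have h1 : q ^ (j + 1) ≤ x := by
    rw [← hj]; exact Nat.pow_log_le_self q (by omega)
  have h2 : x < q ^ (j + 2) := by
    have := Nat.lt_pow_succ_log_self (b := q) (by omega) x
    rwa [hj] at this
  have h3 := Aux.count q hq hodd j x h1
  have h3' : (((q : ℝ) - 1) / 2) ^ j ≤
      (((Finset.Icc 1 x).filter (fun n => Odd (fpq 2 q n))).card : ℝ) := by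
    have e : (((q - 1) / 2 : ℕ) : ℝ) = ((q : ℝ) - 1) / 2 := by
      obtain ⟨m, rfl⟩ := hodd
      have : (2 * m + 1 - 1) / 2 = m := by omega
      rw [this]; push_cast; ring
    rw [← e]
    exact_mod_cast h3
  refine le_trans ?_ h3'
  have h4 : (x : ℝ) ≤ (q : ℝ) ^ 2 * (q : ℝ) ^ j := by
    rw [← pow_add, add_comm]; exact_mod_cast h2.le
  have h5 : (x : ℝ) ^ α ≤ ((q : ℝ) ^ 2) ^ α * (((q : ℝ) - 1) / 2) ^ j := by
    refine (Real.rpow_le_rpow (by positivity) h4 hα0).trans (le_of_eq ?_)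
    rw [Real.mul_rpow (by positivity) (by positivity), ← hqα]
    congr 1
    rw [← Real.rpow_natCast, ← Real.rpow_natCast, ← Real.rpow_mul hq0.le,
      ← Real.rpow_mul hq0.le, mul_comm]
  rw [inv_mul_le_iff₀ (by positivity)]
  exact h5
end
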